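/- Let (X,d,≪,≤,τ) be a finitely τ-measurable Lorentzian pre-length space in which every d_Γ-convergent sequence in TGeo(X) is embeddable, and let R > 0. If for every future-directed timelike geodesic γ ∈ TGeo(X) with L_τ(γ) < R there exists a unique timelike family about γ that is continuous at γ, then for every future-directed timelike geodesic γ ∈ TGeo(X) with L_τ(γ) < R there exists a timelike family that is continuous about γ. -/

import Mathlib

open Set Filter Topology NNReal ENNReal

noncomputable section

/-- A Lorentzian pre-length space structure on a metric space `X`. -/
structure LorentzianPreLengthSpace (X : Type*) [MetricSpace X] where
  chron : X → X → Prop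
  causal : X → X → Prop
  tau : X → X → ℝ≥0∞
  chron_trans : Transitive chron
  causal_trans : Transitive causal
  causal_refl : Reflexive causal
  chron_imp_causal : ∀ {x y : X}, chron x y → causal x y
  tau_lsc : LowerSemicontinuous fun p : X × X => tau p.1 p.2
  tau_eq_zero : ∀ {x y : X}, ¬ causal x y → tau x y = 0
  chron_iff_pos : ∀ x y : X, chron x y ↔ 0 < tau x y
  rev_triangle : ∀ x y z : X, causal x y → causal y z → tau x y + tau y z ≤ tau x z

variable {X : Type*} [MetricSpace X]

/-- `γ` is not constant on any non-trivial subinterval of `[a,b]`. -/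
def NowhereConstantOn (γ : ℝ → X) (a b : ℝ) : Prop :=
  ∀ s t : ℝ, a ≤ s → s < t → t ≤ b → ∃ u, s ≤ u ∧ u ≤ t ∧ γ u ≠ γ s

/-- A future-directed causal curve on `[a,b]`. -/
def IsCausalCurveOn (L : LorentzianPreLengthSpace X) (γ : ℝ → X) (a b : ℝ) : Prop :=
  (∃ K : ℝ≥0, LipschitzOnWith K γ (Icc a b)) ∧ NowhereConstantOn γ a b ∧
    ∀ s t : ℝ, a ≤ s → s < t → t ≤ b → L.causal (γ s) (γ t)

/-- A future-directed timelike curve on `[a,b]`. -/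
def IsTimelikeCurveOn (L : LorentzianPreLengthSpace X) (γ : ℝ → X) (a b : ℝ) : Prop :=
  (∃ K : ℝ≥0, LipschitzOnWith K γ (Icc a b)) ∧ NowhereConstantOn γ a b ∧
    ∀ s t : ℝ, a ≤ s → s < t → t ≤ b → L.chron (γ s) (γ t)

/-- The `τ`-length of a curve on `[a,b]`: the infimum over partitions
`a = t₀ < t₁ < ⋯ < t_N = b` of `Σᵢ τ(γ(tᵢ), γ(tᵢ₊₁))`. -/
def tauLength (L : LorentzianPreLengthSpace X) (γ : ℝ → X) (a b : ℝ) : ℝ≥0∞ :=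
  sInf { s : ℝ≥0∞ | ∃ (N : ℕ) (t : ℕ → ℝ), 1 ≤ N ∧ t 0 = a ∧ t N = b ∧
    StrictMonoOn t (Set.Iic N) ∧
    s = ∑ i ∈ Finset.range N, L.tau (γ (t i)) (γ (t (i + 1))) }

/-- A maximizer on `[a,b]`. -/
def IsMaximizerOn (L : LorentzianPreLengthSpace X) (γ : ℝ → X) (a b : ℝ) : Prop :=
  tauLength L γ a b = L.tau (γ a) (γ b)

/-- A geodesic on `[a,b]`: a causal curve each of whose points has a relative
neighborhood `[a',b'] ⊆ [a,b]` on which the curve is maximizing. -/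
def IsGeodesicOn (L : LorentzianPreLengthSpace X) (γ : ℝ → X) (a b : ℝ) : Prop :=
  IsCausalCurveOn L γ a b ∧
    ∀ t : ℝ, a ≤ t → t ≤ b → ∃ a' b' : ℝ, a ≤ a' ∧ a' ≤ t ∧ t ≤ b' ∧ b' ≤ b ∧
      (a' < t ∨ t = a) ∧ (t < b' ∨ t = b) ∧ IsMaximizerOn L γ a' b'

/-- Every causal curve has finite `τ`-length. -/
def FinitelyTauMeasurable (L : LorentzianPreLengthSpace X) : Prop :=
  ∀ (γ : ℝ → X) (a b : ℝ), a < b → IsCausalCurveOn L γ a b → tauLength L γ a b < ⊤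

/-- A parametrization: a continuous, strictly increasing, surjective self-map of `[0,1]`. -/
def IsParam (φ : ℝ → ℝ) : Prop :=
  ContinuousOn φ (Icc 0 1) ∧ StrictMonoOn φ (Icc 0 1) ∧ φ '' Icc 0 1 = Icc 0 1

/-- Two paths are equivalent if one is a reparametrization of the other. -/
def PathEquiv (γ σ : ℝ → X) : Prop :=
  ∃ φ : ℝ → ℝ, IsParam φ ∧ ∀ t ∈ Icc (0:ℝ) 1, γ t = σ (φ t)

/-- The Fréchet distance of two paths `[0,1] → X`. -/
def frechetDist (γ σ : ℝ → X) : ℝ :=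
  sInf { r : ℝ | ∃ φ ψ : ℝ → ℝ, IsParam φ ∧ IsParam ψ ∧
    ∀ t ∈ Icc (0:ℝ) 1, dist (γ (φ t)) (σ (ψ t)) ≤ r }

/-- The metric `d_Γ` combining Fréchet distance and `τ`-length difference. -/
def dGamma (L : LorentzianPreLengthSpace X) (γ σ : ℝ → X) : ℝ :=
  frechetDist γ σ + |(tauLength L γ 0 1).toReal - (tauLength L σ 0 1).toReal|

/-- `γ` (parametrized on `[0,1]`) represents an element of `TGeo(X)`. -/
def InTGeo (L : LorentzianPreLengthSpace X) (γ : ℝ → X) : Prop :=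
  IsTimelikeCurveOn L γ 0 1 ∧ IsGeodesicOn L γ 0 1


/-- Convergence of a sequence of paths with respect to the metric `d_Γ`. -/
def DGammaTendsto (L : LorentzianPreLengthSpace X) (γs : ℕ → ℝ → X) (γ : ℝ → X) : Prop :=
  Tendsto (fun i => dGamma L (γs i) γ) atTop (𝓝 0)

/-- `p` and `q` are symmetrically conjugate along `γ ∈ TGeo(X)`: there are `pᵢ → p`,
`qᵢ → q` and, for each `i`, two distinct timelike geodesics from `pᵢ` to `qᵢ`, both
converging to `γ` with respect to `d_Γ`. -/
def SymmConjugate (L : LorentzianPreLengthSpace X) (γ : ℝ → X) (p q : X) : Prop :=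
  ∃ (ps qs : ℕ → X) (γs σs : ℕ → ℝ → X),
    Tendsto ps atTop (𝓝 p) ∧ Tendsto qs atTop (𝓝 q) ∧
    (∀ i, InTGeo L (γs i) ∧ InTGeo L (σs i) ∧
      γs i 0 = ps i ∧ γs i 1 = qs i ∧ σs i 0 = ps i ∧ σs i 1 = qs i ∧
      ¬ PathEquiv (γs i) (σs i)) ∧
    DGammaTendsto L γs γ ∧ DGammaTendsto L σs γ

/-- `F` is a timelike family about `γ` on `U × V`. -/
def IsTimelikeFamily (L : LorentzianPreLengthSpace X) (γ : ℝ → X) (U V : Set X)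
    (F : X → X → ℝ → X) : Prop :=
  U ∈ 𝓝 (γ 0) ∧ V ∈ 𝓝 (γ 1) ∧
  (∀ p' ∈ U, ∀ q' ∈ V, L.chron p' q') ∧
  (∀ p' ∈ U, ∀ q' ∈ V, InTGeo L (F p' q') ∧ F p' q' 0 = p' ∧ F p' q' 1 = q') ∧
  PathEquiv (F (γ 0) (γ 1)) γ

/-- The family `F` is continuous (with respect to `d_Γ`) at `γ`, i.e. at `(γ 0, γ 1)`. -/
def FamilyContinuousAt (L : LorentzianPreLengthSpace X) (γ : ℝ → X) (U V : Set X)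
    (F : X → X → ℝ → X) : Prop :=
  ∀ ε > (0:ℝ), ∃ δ > (0:ℝ), ∀ p' ∈ U, ∀ q' ∈ V,
    dist p' (γ 0) < δ → dist q' (γ 1) < δ → dGamma L (F p' q') γ < ε

/-- The family `F` is continuous (with respect to `d_Γ`) about `γ`, i.e. on all of `U × V`. -/
def FamilyContinuousAbout (L : LorentzianPreLengthSpace X) (γ : ℝ → X) (U V : Set X)
    (F : X → X → ℝ → X) : Prop :=
  ∀ p ∈ U, ∀ q ∈ V, ∀ ε > (0:ℝ), ∃ δ > (0:ℝ), ∀ p' ∈ U, ∀ q' ∈ V,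
    dist p' p < δ → dist q' q < δ → dGamma L (F p' q') (F p q) < ε

/-- Two timelike families (defined on `U × V` resp. `U' × V'`) coincide, as maps into
`TGeo(X)`, on a product of neighborhoods `U'' × V''` of `(p, q)` inside the common domain. -/
def FamiliesAgreeNear (p q : X) (U V U' V' : Set X) (F F' : X → X → ℝ → X) : Prop :=
  ∃ U'' ∈ 𝓝 p, ∃ V'' ∈ 𝓝 q, U'' ⊆ U ∩ U' ∧ V'' ⊆ V ∩ V' ∧
    ∀ x ∈ U'', ∀ y ∈ V'', PathEquiv (F x y) (F' x y)

/-- There is a unique (germ of a) timelike family about `γ` that is continuous at `γ`. -/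
def UniqueContFamilyAt (L : LorentzianPreLengthSpace X) (γ : ℝ → X) : Prop :=
  (∃ U V F, IsTimelikeFamily L γ U V F ∧ FamilyContinuousAt L γ U V F) ∧
  (∀ U V F U' V' F', IsTimelikeFamily L γ U V F → FamilyContinuousAt L γ U V F →
    IsTimelikeFamily L γ U' V' F' → FamilyContinuousAt L γ U' V' F' →
    FamiliesAgreeNear (γ 0) (γ 1) U V U' V' F F')

/-- `γ` is embeddable: there is a timelike family about `γ` that is continuous at `γ`. -/
def Embeddable (L : LorentzianPreLengthSpace X) (γ : ℝ → X) : Prop :=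
  ∃ U V F, IsTimelikeFamily L γ U V F ∧ FamilyContinuousAt L γ U V F

/-- A `d_Γ`-convergent sequence `(γᵢ)` in `TGeo(X)` with limit `γ` is embeddable: some
timelike family about `γ`, continuous at `γ`, eventually passes through the `γᵢ`. -/
def SeqEmbeddable (L : LorentzianPreLengthSpace X) (γs : ℕ → ℝ → X) (γ : ℝ → X) : Prop :=
  ∃ U V F, IsTimelikeFamily L γ U V F ∧ FamilyContinuousAt L γ U V F ∧
    ∃ i₀ : ℕ, ∀ i ≥ i₀, γs i 0 ∈ U ∧ γs i 1 ∈ V ∧ PathEquiv (F (γs i 0) (γs i 1)) (γs i)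

lemma IsParam.exists_orderIso {φ : ℝ → ℝ} (h : IsParam φ) :
    ∃ e : Icc (0:ℝ) 1 ≃o Icc (0:ℝ) 1, ∀ t : Icc (0:ℝ) 1, φ t = e t := by
  obtain ⟨-, hm, hi⟩ := h
  exact ⟨(hm.orderIso φ _).trans (OrderIso.setCongr _ _ hi), fun t => rfl⟩

lemma IsParam.of_orderIso (e : Icc (0:ℝ) 1 ≃o Icc (0:ℝ) 1) :
    IsParam (fun t => (e (projIcc 0 1 zero_le_one t) : ℝ)) := by
  refine ⟨?_, ?_, ?_⟩
  · exact (continuous_subtype_val.comp (e.continuous.comp continuous_projIcc)).continuousOn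
  · intro s hs t ht hst
    simpa [projIcc_of_mem zero_le_one hs, projIcc_of_mem zero_le_one ht] using hst
  · ext u
    constructor
    · rintro ⟨t, -, rfl⟩
      exact (e _).2
    · intro hu
      refine ⟨e.symm ⟨u, hu⟩, (e.symm ⟨u, hu⟩).2, ?_⟩
      simp

lemma IsParam.id : IsParam (fun t => t) := by
  refine ⟨continuousOn_id, fun s _ t _ h => h, ?_⟩
  simp

lemma IsParam.mem_Icc {φ : ℝ → ℝ} (h : IsParam φ) {t : ℝ} (ht : t ∈ Icc (0:ℝ) 1) :
    φ t ∈ Icc (0:ℝ) 1 :=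
  h.2.2 ▸ mem_image_of_mem φ ht

lemma IsParam.comp {φ ψ : ℝ → ℝ} (hφ : IsParam φ) (hψ : IsParam ψ) :
    IsParam (fun t => φ (ψ t)) := by
  refine ⟨hφ.1.comp hψ.1 fun t ht => hψ.mem_Icc ht,
    fun s hs t ht hst => hφ.2.1 (hψ.mem_Icc hs) (hψ.mem_Icc ht) (hψ.2.1 hs ht hst), ?_⟩
  calc (fun t => φ (ψ t)) '' Icc 0 1 = φ '' (ψ '' Icc 0 1) := (image_image φ ψ _).symm
    _ = Icc 0 1 := by rw [hψ.2.2, hφ.2.2]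

lemma IsParam.exists_rightInverse {φ : ℝ → ℝ} (h : IsParam φ) :
    ∃ ψ : ℝ → ℝ, IsParam ψ ∧ ∀ t ∈ Icc (0:ℝ) 1, φ (ψ t) = t := by
  obtain ⟨e, he⟩ := h.exists_orderIso
  refine ⟨_, IsParam.of_orderIso e.symm, fun t ht => ?_⟩
  rw [he, e.apply_symm_apply, projIcc_of_mem zero_le_one ht]

lemma IsParam.map_zero {φ : ℝ → ℝ} (h : IsParam φ) : φ 0 = 0 := by
  obtain ⟨e, he⟩ := h.exists_orderIso
  have h0 : e ⊥ = ⊥ := e.map_bot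
  exact (he ⊥).trans (congrArg Subtype.val h0)

lemma IsParam.map_one {φ : ℝ → ℝ} (h : IsParam φ) : φ 1 = 1 := by
  obtain ⟨e, he⟩ := h.exists_orderIso
  have h1 : e ⊤ = ⊤ := e.map_top
  exact (he ⊤).trans (congrArg Subtype.val h1)

lemma PathEquiv.symm {γ σ : ℝ → X} (h : PathEquiv γ σ) : PathEquiv σ γ := by
  obtain ⟨φ, hφ, hγ⟩ := h
  obtain ⟨ψ, hψ, hinv⟩ := hφ.exists_rightInverse
  refine ⟨ψ, hψ, fun t ht => ?_⟩
  rw [hγ _ (hψ.mem_Icc ht), hinv t ht]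

lemma PathEquiv.tauLength_le (L : LorentzianPreLengthSpace X) {γ σ : ℝ → X}
    (h : PathEquiv γ σ) : tauLength L σ 0 1 ≤ tauLength L γ 0 1 := by
  obtain ⟨φ, hφ, hγ⟩ := h
  refine sInf_le_sInf ?_
  rintro s ⟨N, t, hN, h0, h1, hmono, rfl⟩
  have hmem : ∀ i ≤ N, t i ∈ Icc (0:ℝ) 1 := fun i hi =>
    ⟨h0 ▸ hmono.monotoneOn (mem_Iic.2 N.zero_le) (mem_Iic.2 hi) i.zero_le,
      h1 ▸ hmono.monotoneOn (mem_Iic.2 hi) (mem_Iic.2 le_rfl) hi⟩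
  refine ⟨N, fun i => φ (t i), hN, by simp [h0, hφ.map_zero], by simp [h1, hφ.map_one],
    fun i hi j hj hij => hφ.2.1 (hmem i hi) (hmem j hj) (hmono hi hj hij),
    Finset.sum_congr rfl fun i hi => ?_⟩
  have hi' := Finset.mem_range.1 hi
  rw [hγ _ (hmem i hi'.le), hγ _ (hmem (i + 1) hi')]

lemma PathEquiv.tauLength_eq (L : LorentzianPreLengthSpace X) {γ σ : ℝ → X}
    (h : PathEquiv γ σ) : tauLength L γ 0 1 = tauLength L σ 0 1 :=
  le_antisymm (h.symm.tauLength_le L) (h.tauLength_le L)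

lemma nonneg_of_forall_dist_le (γ σ : ℝ → X) :
    ∀ r ∈ { r : ℝ | ∃ φ ψ : ℝ → ℝ, IsParam φ ∧ IsParam ψ ∧
      ∀ t ∈ Icc (0:ℝ) 1, dist (γ (φ t)) (σ (ψ t)) ≤ r }, 0 ≤ r := by
  rintro r ⟨φ, ψ, -, -, h⟩
  exact dist_nonneg.trans (h 0 (by simp))

lemma frechetDist_nonneg (γ σ : ℝ → X) : 0 ≤ frechetDist γ σ :=
  Real.sInf_nonneg (nonneg_of_forall_dist_le γ σ)

lemma frechetDist_le {γ σ : ℝ → X} {φ ψ : ℝ → ℝ} {r : ℝ} (hφ : IsParam φ) (hψ : IsParam ψ)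
    (h : ∀ t ∈ Icc (0:ℝ) 1, dist (γ (φ t)) (σ (ψ t)) ≤ r) : frechetDist γ σ ≤ r :=
  csInf_le ⟨0, nonneg_of_forall_dist_le γ σ⟩ ⟨φ, ψ, hφ, hψ, h⟩

lemma exists_of_frechetDist_lt {γ σ : ℝ → X} (hγ : ContinuousOn γ (Icc 0 1))
    (hσ : ContinuousOn σ (Icc 0 1)) {r : ℝ} (h : frechetDist γ σ < r) :
    ∃ φ ψ : ℝ → ℝ, IsParam φ ∧ IsParam ψ ∧
      ∀ t ∈ Icc (0:ℝ) 1, dist (γ (φ t)) (σ (ψ t)) ≤ r := by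
  obtain ⟨C, hC⟩ :=
    isCompact_Icc.bddAbove_image (continuous_dist.comp_continuousOn (hγ.prodMk hσ))
  unfold frechetDist at h
  obtain ⟨s, ⟨φ, ψ, hφ, hψ, hs⟩, hsr⟩ := exists_lt_of_csInf_lt
    (by exact ⟨C, fun t => t, fun t => t, IsParam.id, IsParam.id,
      fun t ht => hC (mem_image_of_mem _ ht)⟩) h
  exact ⟨φ, ψ, hφ, hψ, fun t ht => (hs t ht).trans hsr.le⟩

lemma frechetDist_triangle {α β γ : ℝ → X} (hα : ContinuousOn α (Icc 0 1))
    (hβ : ContinuousOn β (Icc 0 1)) (hγ : ContinuousOn γ (Icc 0 1)) :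
    frechetDist α γ ≤ frechetDist α β + frechetDist β γ := by
  refine le_of_forall_pos_le_add fun ε hε => ?_
  obtain ⟨φ₁, ψ₁, hφ₁, hψ₁, h₁⟩ :=
    exists_of_frechetDist_lt hα hβ (lt_add_of_pos_right (frechetDist α β) (half_pos hε))
  obtain ⟨φ₂, ψ₂, hφ₂, hψ₂, h₂⟩ :=
    exists_of_frechetDist_lt hβ hγ (lt_add_of_pos_right (frechetDist β γ) (half_pos hε))
  obtain ⟨χ, hχ, hinv⟩ := hψ₁.exists_rightInverse
  refine frechetDist_le (hφ₁.comp (hχ.comp hφ₂)) hψ₂ fun t ht => ?_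
  have h := h₁ _ (hχ.mem_Icc (hφ₂.mem_Icc ht))
  rw [hinv _ (hφ₂.mem_Icc ht)] at h
  linarith [dist_triangle (α (φ₁ (χ (φ₂ t)))) (β (φ₂ t)) (γ (ψ₂ t)), h₂ t ht]

lemma InTGeo.continuousOn {L : LorentzianPreLengthSpace X} {γ : ℝ → X} (h : InTGeo L γ) :
    ContinuousOn γ (Icc 0 1) :=
  h.1.1.elim fun _ hK => hK.continuousOn

lemma dGamma_nonneg (L : LorentzianPreLengthSpace X) (γ σ : ℝ → X) : 0 ≤ dGamma L γ σ :=
  add_nonneg (frechetDist_nonneg γ σ) (abs_nonneg _)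

lemma dGamma_triangle {L : LorentzianPreLengthSpace X} {α β γ : ℝ → X} (hα : InTGeo L α)
    (hβ : InTGeo L β) (hγ : InTGeo L γ) :
    dGamma L α γ ≤ dGamma L α β + dGamma L β γ := by
  have h := frechetDist_triangle hα.continuousOn hβ.continuousOn hγ.continuousOn
  have h' := abs_sub_le (tauLength L α 0 1).toReal (tauLength L β 0 1).toReal
    (tauLength L γ 0 1).toReal
  unfold dGamma
  linarith

lemma tauLength_le_add_dGamma (L : LorentzianPreLengthSpace X) (γ σ : ℝ → X) :
    (tauLength L γ 0 1).toReal ≤ (tauLength L σ 0 1).toReal + dGamma L γ σ := by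
  have h := le_abs_self ((tauLength L γ 0 1).toReal - (tauLength L σ 0 1).toReal)
  have h' := frechetDist_nonneg γ σ
  unfold dGamma
  linarith

lemma PathEquiv.dGamma_eq_zero (L : LorentzianPreLengthSpace X) {γ σ : ℝ → X}
    (h : PathEquiv γ σ) : dGamma L γ σ = 0 := by
  have hτ := h.tauLength_eq L
  obtain ⟨φ, hφ, hγ⟩ := h
  have h0 : frechetDist γ σ ≤ 0 :=
    frechetDist_le IsParam.id hφ fun t ht => by rw [hγ t ht, dist_self]
  simp [dGamma, hτ, le_antisymm h0 (frechetDist_nonneg γ σ)]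

lemma IsTimelikeFamily.mono {L : LorentzianPreLengthSpace X} {γ : ℝ → X} {U V U' V' : Set X}
    {F : X → X → ℝ → X} (hF : IsTimelikeFamily L γ U V F) (hU : U' ⊆ U) (hV : V' ⊆ V)
    (hU' : U' ∈ 𝓝 (γ 0)) (hV' : V' ∈ 𝓝 (γ 1)) : IsTimelikeFamily L γ U' V' F :=
  ⟨hU', hV', fun p hp q hq => hF.2.2.1 p (hU hp) q (hV hq),
    fun p hp q hq => hF.2.2.2.1 p (hU hp) q (hV hq), hF.2.2.2.2⟩

/-- If a timelike family about `γ` is continuous at `γ` but not about `γ` on any smaller product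
of neighborhoods, then arbitrarily close to `γ` there are timelike geodesics which do not belong
to the family, although their endpoints lie in its domain. -/
lemma exists_geodesic_near_not_in_family {L : LorentzianPreLengthSpace X} {R : ℝ}
    (hex : ∀ σ : ℝ → X, InTGeo L σ → (tauLength L σ 0 1).toReal < R → Embeddable L σ)
    {γ : ℝ → X} (hγ : InTGeo L γ) (hγR : (tauLength L γ 0 1).toReal < R) {U V : Set X}
    {F : X → X → ℝ → X} (hF : IsTimelikeFamily L γ U V F) (hc : FamilyContinuousAt L γ U V F)
    (hnot : ¬ ∃ U V F, IsTimelikeFamily L γ U V F ∧ FamilyContinuousAbout L γ U V F)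
    {ε : ℝ} (hε : 0 < ε) :
    ∃ g : ℝ → X, InTGeo L g ∧ dist (g 0) (γ 0) < ε ∧ dist (g 1) (γ 1) < ε ∧
      dGamma L g γ < ε ∧ 0 < dGamma L (F (g 0) (g 1)) g := by
  obtain ⟨δ, hδ, hFδ⟩ := hc (min (ε / 2) (R - (tauLength L γ 0 1).toReal))
    (lt_min (half_pos hε) (sub_pos.2 hγR))
  set r := min δ ε
  have hr0 : 0 < r := lt_min hδ hε
  set U' := U ∩ Metric.ball (γ 0) r
  set V' := V ∩ Metric.ball (γ 1) r
  have hnc : ¬ FamilyContinuousAbout L γ U' V' F := fun h => hnot ⟨U', V', F,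
    hF.mono inter_subset_left inter_subset_left
      (inter_mem hF.1 (Metric.ball_mem_nhds _ hr0))
      (inter_mem hF.2.1 (Metric.ball_mem_nhds _ hr0)), h⟩
  unfold FamilyContinuousAbout at hnc
  push Not at hnc
  obtain ⟨p, hp, q, hq, η, hη, hdisc⟩ := hnc
  obtain ⟨hσ, hσ0, hσ1⟩ := hF.2.2.2.1 p hp.1 q hq.1
  have hσγ := hFδ p hp.1 q hq.1 ((Metric.mem_ball.1 hp.2).trans_le (min_le_left _ _))
    ((Metric.mem_ball.1 hq.2).trans_le (min_le_left _ _))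
  have hσR : (tauLength L (F p q) 0 1).toReal < R := by
    linarith [tauLength_le_add_dGamma L (F p q) γ, hσγ.trans_le (min_le_right _ _)]
  obtain ⟨A, B, G, hG, hGc⟩ := hex _ hσ hσR
  obtain ⟨ρ, hρ, hGρ⟩ := hGc (min η (ε / 2)) (lt_min hη (half_pos hε))
  have hA := hG.1
  have hB := hG.2.1
  rw [hσ0, hσ1] at hGρ
  rw [hσ0] at hA
  rw [hσ1] at hB
  obtain ⟨a, ha, hA'⟩ := Metric.mem_nhds_iff.1 hA
  obtain ⟨b, hb, hB'⟩ := Metric.mem_nhds_iff.1 hB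
  obtain ⟨x, hx, y, hy, hxp, hyq, hfar⟩ := hdisc (min ρ (min a b)) (by positivity)
  have hxA : x ∈ A := hA' (hxp.trans_le ((min_le_right _ _).trans (min_le_left _ _)))
  have hyB : y ∈ B := hB' (hyq.trans_le ((min_le_right _ _).trans (min_le_right _ _)))
  obtain ⟨hg, hg0, hg1⟩ := hG.2.2.2.1 x hxA y hyB
  have hnear := hGρ x hxA y hyB (hxp.trans_le (min_le_left _ _)) (hyq.trans_le (min_le_left _ _))
  refine ⟨G x y, hg, ?_, ?_, ?_, ?_⟩
  · rw [hg0]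
    exact (Metric.mem_ball.1 hx.2).trans_le (min_le_right _ _)
  · rw [hg1]
    exact (Metric.mem_ball.1 hy.2).trans_le (min_le_right _ _)
  · linarith [dGamma_triangle hg hσ hγ, hnear.trans_le (min_le_right _ _),
      hσγ.trans_le (min_le_left _ _)]
  · rw [hg0, hg1]
    linarith [dGamma_triangle (hF.2.2.2.1 x hx.1 y hy.1).1 hg hσ,
      hnear.trans_le (min_le_left _ _)]

/-- Suppose every `d_Γ`-convergent sequence in `TGeo(X)` is embeddable.
If every timelike geodesic of `τ`-length `< R` admits a unique timelike family continuous
at it, then every timelike geodesic of `τ`-length `< R` admits a timelike family that is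
continuous about it. -/
theorem continuousAbout_family_of_unique
    {X : Type*} [MetricSpace X] (L : LorentzianPreLengthSpace X)
    (hfin : FinitelyTauMeasurable L)
    (hembed : ∀ (γs : ℕ → ℝ → X) (γ : ℝ → X), (∀ i, InTGeo L (γs i)) → InTGeo L γ →
      DGammaTendsto L γs γ → SeqEmbeddable L γs γ)
    (R : ℝ) (hR : 0 < R)
    (huniq : ∀ γ : ℝ → X, InTGeo L γ → (tauLength L γ 0 1).toReal < R →
      UniqueContFamilyAt L γ) :
    ∀ γ : ℝ → X, InTGeo L γ → (tauLength L γ 0 1).toReal < R →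
      ∃ U V F, IsTimelikeFamily L γ U V F ∧ FamilyContinuousAbout L γ U V F := by
  intro γ hγ hγR
  by_contra hnot
  obtain ⟨⟨U, V, F, hF, hc⟩, hun⟩ := huniq γ hγ hγR
  choose g hg hg0 hg1 hgγ hgF using fun n : ℕ =>
    exists_geodesic_near_not_in_family (fun σ hσ hσR => (huniq σ hσ hσR).1) hγ hγR hF hc hnot
      (Nat.one_div_pos_of_nat (α := ℝ) (n := n))
  have hlim := tendsto_one_div_add_atTop_nhds_zero_nat (𝕜 := ℝ)
  have h0 : Tendsto (fun n => g n 0) atTop (𝓝 (γ 0)) := tendsto_iff_dist_tendsto_zero.2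
    (squeeze_zero (fun _ => dist_nonneg) (fun n => (hg0 n).le) hlim)
  have h1 : Tendsto (fun n => g n 1) atTop (𝓝 (γ 1)) := tendsto_iff_dist_tendsto_zero.2
    (squeeze_zero (fun _ => dist_nonneg) (fun n => (hg1 n).le) hlim)
  have hconv : DGammaTendsto L g γ :=
    squeeze_zero (fun _ => dGamma_nonneg L _ _) (fun n => (hgγ n).le) hlim
  obtain ⟨U', V', F', hF', hc', i₀, hi₀⟩ := hembed g γ hg hγ hconv
  obtain ⟨U'', hU'', V'', hV'', hUsub, hVsub, hagree⟩ := hun U V F U' V' F' hF hc hF' hc'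
  obtain ⟨n, hn0, hn1, hn⟩ :=
    ((h0.eventually_mem hU'').and ((h1.eventually_mem hV'').and (eventually_ge_atTop i₀))).exists
  have hFF' := (hagree _ hn0 _ hn1).dGamma_eq_zero L
  have hF'g := (hi₀ n hn).2.2.dGamma_eq_zero L
  have htri := dGamma_triangle (hF.2.2.2.1 _ (hUsub hn0).1 _ (hVsub hn1).1).1
    (hF'.2.2.2.1 _ (hUsub hn0).2 _ (hVsub hn1).2).1 (hg n)
  linarith [hgF n]

end
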